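/- Let d be a positive integer and let J ⊊ I be squarefree monomial ideals of S such that I is minimally generated by squarefree monomials f_1,…,f_r of degree d together with a set E of squarefree monomials of degrees ≥ d+1, and J is either 0 or generated by squarefree monomials of degrees ≥ d+1. If s < 2r, then sdepth_S I/J ≤ d+1. -/

import Mathlib

open MvPolynomial

/-- The squarefree monomial `∏_{i ∈ T} x_i` in `K[x_1,…,x_n]`. -/
noncomputable def sqm (K : Type*) [Field K] {n : ℕ} (T : Finset (Fin n)) :
    MvPolynomial (Fin n) K := ∏ i ∈ T, X i

/-- The poset `P_{I \ J}` of (supports of) squarefree monomials of `I \ J`. -/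
def sqPoset {K : Type*} [Field K] {n : ℕ} (I J : Ideal (MvPolynomial (Fin n) K)) :
    Set (Finset (Fin n)) :=
  {T | sqm K T ∈ I ∧ sqm K T ∉ J}

/-- The squarefree monomials of degree `k` in `I \ J`. -/
def degSet {K : Type*} [Field K] {n : ℕ} (I J : Ideal (MvPolynomial (Fin n) K)) (k : ℕ) :
    Set (Finset (Fin n)) :=
  {T ∈ sqPoset I J | T.card = k}

/-- A partition of `P_{I\J}` into intervals `[u,v]`, recorded as a finite set of
pairs `(u, v)`: each monomial of `P_{I\J}` lies in exactly one interval. -/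
def IsIntervalPartition {K : Type*} [Field K] {n : ℕ}
    (I J : Ideal (MvPolynomial (Fin n) K))
    (F : Finset (Finset (Fin n) × Finset (Fin n))) : Prop :=
  (∀ p ∈ F, p.1 ∈ sqPoset I J ∧ p.2 ∈ sqPoset I J ∧ p.1 ⊆ p.2) ∧
  (∀ T ∈ sqPoset I J, ∃! p, p ∈ F ∧ p.1 ⊆ T ∧ T ⊆ p.2)

/-- The Stanley depth of `I/J`: the maximum over interval partitions of the
minimal degree of an upper endpoint. -/
noncomputable def sdepth {K : Type*} [Field K] {n : ℕ}
    (I J : Ideal (MvPolynomial (Fin n) K)) : ℕ :=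
  sSup {k | ∃ F, IsIntervalPartition I J F ∧ ∀ p ∈ F, k ≤ p.2.card}

/-- The depth of a module over `K[x_1,…,x_n]` with respect to the maximal ideal
`(x_1,…,x_n)`: the supremum of lengths of regular sequences from `(x_1,…,x_n)`. -/
noncomputable def mdepth {K : Type*} [Field K] {n : ℕ}
    (M : Type*) [AddCommGroup M] [Module (MvPolynomial (Fin n) K) M] : ℕ :=
  sSup {k | ∃ rs : List (MvPolynomial (Fin n) K), rs.length = k ∧
    (∀ r ∈ rs, r ∈ Ideal.span (Set.range X : Set (MvPolynomial (Fin n) K))) ∧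
    RingTheory.Sequence.IsRegular M rs}

/-- The `S`-module `I/J` (more precisely `I/(J ∩ I)`). -/
abbrev quotMod {K : Type*} [Field K] {n : ℕ} (I J : Ideal (MvPolynomial (Fin n) K)) :=
  I ⧸ (Submodule.comap I.subtype J)

/-- `depth_S I/J`. -/
noncomputable def depthIJ {K : Type*} [Field K] {n : ℕ}
    (I J : Ideal (MvPolynomial (Fin n) K)) : ℕ :=
  mdepth (K := K) (n := n) (quotMod I J)

/-- An ideal is a squarefree monomial ideal generated in degrees `≥ d` if it is
the span of squarefree monomials whose supports have at least `d` elements. -/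
def SqfreeGenFrom {K : Type*} [Field K] {n : ℕ}
    (L : Ideal (MvPolynomial (Fin n) K)) (d : ℕ) : Prop :=
  ∃ G : Set (Finset (Fin n)), (∀ T ∈ G, d ≤ T.card) ∧ L = Ideal.span (sqm K '' G)

/-- A squarefree monomial ideal. -/
def IsSqfreeMonomialIdeal {K : Type*} [Field K] {n : ℕ}
    (L : Ideal (MvPolynomial (Fin n) K)) : Prop :=
  ∃ G : Set (Finset (Fin n)), L = Ideal.span (sqm K '' G)

theorem sqm_eq_monomial (K : Type*) [Field K] {n : ℕ} (T : Finset (Fin n)) :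
    sqm K T = monomial (∑ i ∈ T, Finsupp.single i 1) 1 := by
  rw [monomial_sum_one]
  rfl

theorem exists_subset_of_sqm_mem_span {K : Type*} [Field K] {n : ℕ} {G : Set (Finset (Fin n))}
    {T : Finset (Fin n)} (h : sqm K T ∈ Ideal.span (sqm K '' G)) : ∃ g ∈ G, g ⊆ T := by
  classical
  have hG : sqm K '' G = (fun e => monomial e (1 : K)) ''
      ((fun g : Finset (Fin n) => ∑ i ∈ g, Finsupp.single i 1) '' G) := by
    rw [Set.image_image]
    exact Set.image_congr fun g _ => sqm_eq_monomial K g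
  rw [hG, mem_ideal_span_monomial_image] at h
  obtain ⟨_, ⟨g, hg, rfl⟩, hle⟩ := h (∑ i ∈ T, Finsupp.single i 1) (by
    simp [sqm_eq_monomial])
  refine ⟨g, hg, fun i hi => ?_⟩
  have hi' := hle i
  by_contra hiT
  simp [Finsupp.finsetSum_apply, Finsupp.single_apply, hi, hiT] at hi'

theorem sqm_mem_of_subset {K : Type*} [Field K] {n : ℕ} {L : Ideal (MvPolynomial (Fin n) K)}
    {T U : Finset (Fin n)} (hT : sqm K T ∈ L) (hTU : T ⊆ U) : sqm K U ∈ L :=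
  L.mem_of_dvd (Finset.prod_dvd_prod_of_subset T U X hTU) hT

/-- `P_{I \ J}` is convex for divisibility. -/
theorem mem_sqPoset_of_subset_of_subset {K : Type*} [Field K] {n : ℕ}
    {I J : Ideal (MvPolynomial (Fin n) K)} {u T v : Finset (Fin n)}
    (hu : u ∈ sqPoset I J) (hv : v ∈ sqPoset I J) (huT : u ⊆ T) (hTv : T ⊆ v) :
    T ∈ sqPoset I J :=
  ⟨sqm_mem_of_subset hu.1 huT, fun hT => hv.2 (sqm_mem_of_subset hT hTv)⟩

/-- In an interval partition whose upper endpoints have degree at least `d + 2`, the monomials of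
minimal degree `d` are lower endpoints of disjoint intervals, each of which contains at least two
monomials of degree `d + 1`. -/
theorem two_mul_le_ncard_degSet {K : Type*} [Field K] {n d r : ℕ}
    {I J : Ideal (MvPolynomial (Fin n) K)} {f : Fin r → Finset (Fin n)}
    (hfinj : Function.Injective f) (hfd : ∀ i, (f i).card = d)
    (hf : ∀ i, f i ∈ sqPoset I J) (hmin : ∀ T ∈ sqPoset I J, d ≤ T.card)
    {F : Finset (Finset (Fin n) × Finset (Fin n))} (hF : IsIntervalPartition I J F)
    (hcard : ∀ p ∈ F, d + 2 ≤ p.2.card) :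
    2 * r ≤ (degSet I J (d + 1)).ncard := by
  classical
  have hv : ∀ i, ∃ v, (f i, v) ∈ F := fun i => by
    obtain ⟨⟨u, v⟩, ⟨hp, hu, -⟩, -⟩ := hF.2 (f i) (hf i)
    have huf : u = f i := Finset.eq_of_subset_of_card_le hu
      ((hfd i).trans_le (hmin u (hF.1 _ hp).1))
    exact ⟨v, huf ▸ hp⟩
  choose v hv using hv
  have hfv : ∀ i, f i ⊆ v i := fun i => (hF.1 _ (hv i)).2.2
  let B : Fin r → Finset (Finset (Fin n)) := fun i =>
    (v i \ f i).image fun a => insert a (f i)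
  have hB : ∀ i, ∀ T ∈ B i, T ∈ degSet I J (d + 1) ∧ f i ⊆ T ∧ T ⊆ v i := by
    intro i T hT
    obtain ⟨a, ha, rfl⟩ := Finset.mem_image.1 hT
    obtain ⟨hav, haf⟩ := Finset.mem_sdiff.1 ha
    have h₁ := Finset.subset_insert a (f i)
    have h₂ := Finset.insert_subset hav (hfv i)
    exact ⟨⟨mem_sqPoset_of_subset_of_subset (hf i) (hF.1 _ (hv i)).2.1 h₁ h₂,
      by rw [Finset.card_insert_of_notMem haf, hfd]⟩, h₁, h₂⟩
  have hBcard : ∀ i, 2 ≤ (B i).card := by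
    intro i
    rw [Finset.card_image_of_injOn, Finset.card_sdiff_of_subset (hfv i), hfd]
    · have := hcard _ (hv i)
      dsimp only at this
      omega
    · intro a ha b _ hab
      have haf := (Finset.mem_sdiff.1 (Finset.mem_coe.1 ha)).2
      exact (Finset.insert_inj haf).1 hab
  have hdisj : ∀ i ∈ Finset.univ, ∀ j ∈ Finset.univ, i ≠ j → Disjoint (B i) (B j) := by
    intro i _ j _ hij
    refine Finset.disjoint_left.2 fun T hi hj => hij (hfinj ?_)
    obtain ⟨hT, hi⟩ := hB i T hi
    obtain ⟨-, hj⟩ := hB j T hj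
    exact congrArg Prod.fst ((hF.2 T hT.1).unique ⟨hv i, hi⟩ ⟨hv j, hj⟩)
  calc 2 * r = ∑ _i : Fin r, 2 := by simp [mul_comm]
    _ ≤ ∑ i, (B i).card := Finset.sum_le_sum fun i _ => hBcard i
    _ = (Finset.univ.biUnion B).card := (Finset.card_biUnion hdisj).symm
    _ = ((Finset.univ.biUnion B : Finset (Finset (Fin n))) : Set (Finset (Fin n))).ncard :=
      (Set.ncard_coe_finset _).symm
    _ ≤ (degSet I J (d + 1)).ncard := Set.ncard_le_ncard (fun T hT => by
      obtain ⟨i, -, hi⟩ := Finset.mem_biUnion.1 (Finset.mem_coe.1 hT)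
      exact (hB i T hi).1) (Set.toFinite _)

/-- if `s < 2r` then `sdepth I/J ≤ d + 1`. -/
theorem statement13 {K : Type*} [Field K] {n : ℕ} (d : ℕ) (hd : 0 < d) (r : ℕ)
    (I J : Ideal (MvPolynomial (Fin n) K)) (hJI : J < I)
    (f : Fin r → Finset (Fin n)) (hfinj : Function.Injective f)
    (hfd : ∀ i, (f i).card = d)
    (E : Set (Finset (Fin n))) (hE : ∀ T ∈ E, d + 1 ≤ T.card)
    (hI : I = Ideal.span (sqm K '' (Set.range f ∪ E)))
    (hmin : ∀ g ∈ Set.range f ∪ E,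
      sqm K g ∉ Ideal.span (sqm K '' ((Set.range f ∪ E) \ {g})))
    (hJ : SqfreeGenFrom J (d + 1))
    (hsr : (degSet I J (d + 1)).ncard < 2 * r) :
    sdepth I J ≤ d + 1 := by
  obtain ⟨G, hG, rfl⟩ := hJ
  have hdeg : ∀ T ∈ sqPoset I (Ideal.span (sqm K '' G)), d ≤ T.card := by
    rintro T ⟨hT, -⟩
    rw [hI] at hT
    obtain ⟨g, hg | hg, hgT⟩ := exists_subset_of_sqm_mem_span hT
    · obtain ⟨i, rfl⟩ := hg
      exact (hfd i).symm.trans_le (Finset.card_le_card hgT)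
    · exact (Nat.le_succ d).trans ((hE g hg).trans (Finset.card_le_card hgT))
  have hf : ∀ i, f i ∈ sqPoset I (Ideal.span (sqm K '' G)) := by
    refine fun i => ⟨hI ▸ Ideal.subset_span ⟨f i, Or.inl ⟨i, rfl⟩, rfl⟩, fun h => ?_⟩
    obtain ⟨g, hg, hgf⟩ := exists_subset_of_sqm_mem_span h
    have := (hG g hg).trans (Finset.card_le_card hgf)
    rw [hfd] at this
    omega
  refine csSup_le' ?_
  rintro k ⟨F, hF, hk⟩
  by_contra! hlt
  exact hsr.not_ge (two_mul_le_ncard_degSet hfinj hfd hf hdeg hF fun p hp => hlt.trans_le (hk p hp))
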